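/- Let n = 8 and w = (2, 4, 7, 5, 4, 2, 5, 7) ∈ 𝒮_8. Then H_k⟦w⟧ ≅ ℤ/8ℤ for k ∈ {10, 11} and H_k⟦w⟧ = 0 for k ∉ {10, 11}. Consequently H_{10}(𝔫𝔦𝔩_8; ℤ) contains an element of order 8, so H_*(𝔫𝔦𝔩_8; ℤ) has 8-torsion even though 8 > 8 − 2. -/

import Mathlib

namespace Nil

/-- Index pairs `(a,b)` with `a < b` in `Fin n`, indexing the basis `e_{ab}` of `nil_n`. -/
abbrev P (n : ℕ) : Type := {p : Fin n × Fin n // p.1 < p.2}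

/-- Lexicographic key of a pair. -/
def key {n : ℕ} (p : P n) : ℕ := p.1.1.1 * n + p.1.2.1

/-- Position (0-based) of `a` in the lexicographically sorted list of `M`. -/
def pos {n : ℕ} (M : Finset (P n)) (a : P n) : ℕ :=
  (M.filter fun b => key b < key a).card

/-- Basis of the degree `k` part of the Chevalley-Eilenberg complex `Λ^* nil_n`:
subsets `M` of pairs with `|M| = k` (empty for `k < 0`). -/
abbrev B (n : ℕ) (k : ℤ) : Type := {M : Finset (P n) // (M.card : ℤ) = k}

/-- Degree `k` chain group of the Chevalley-Eilenberg complex of `nil_n`. -/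
abbrev C (n : ℕ) (k : ℤ) : Type := B n k →₀ ℤ

/-- The Chevalley-Eilenberg boundary of a basis wedge `e_M`:
`∂(e_{a₁b₁} ∧ … ∧ e_{aₖbₖ}) = Σ_{i<j} (-1)^{i+j} [e_{aᵢbᵢ}, e_{aⱼbⱼ}] ∧ …` (omitting
the i-th and j-th factors), written in the lexicographically sorted basis.
For lexicographically sorted wedges the only nonzero brackets come from pairs
`a = (x,y)`, `b = (y,z)`, producing `±e_{(x,z)}`. -/
noncomputable def dAux {n : ℕ} (k : ℤ) (M : Finset (P n)) : C n k :=
  ∑ a ∈ M, ∑ b ∈ M,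
    if hab : a.1.2 = b.1.1 then
      (let c : P n := ⟨(a.1.1, b.1.2), lt_trans a.2 (by rw [hab]; exact b.2)⟩
       let M' : Finset (P n) := insert c ((M.erase a).erase b)
       if h' : (M'.card : ℤ) = k then
         ((-1 : ℤ) ^ (pos M a + pos M b + pos M' c)) • Finsupp.single (⟨M', h'⟩ : B n k) 1
       else 0)
    else 0

/-- The Chevalley-Eilenberg boundary map in degree `k+1`. -/
noncomputable def d (n : ℕ) (k : ℤ) : C n (k + 1) →ₗ[ℤ] C n k :=
  Finsupp.lsum ℤ fun M => LinearMap.toSpanSingleton ℤ (C n k) (dAux k M.1)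

/-- Degree-cast isomorphism. -/
noncomputable def castC (n : ℕ) {k l : ℤ} (h : k = l) : C n k ≃ₗ[ℤ] C n l :=
  Finsupp.domLCongr (Equiv.subtypeEquivRight fun _ => by rw [h])

/-- The boundary map out of degree `k`. -/
noncomputable def dFrom (n : ℕ) (k : ℤ) : C n k →ₗ[ℤ] C n (k - 1) :=
  (d n (k - 1)).comp (castC n (by ring : k = k - 1 + 1)).toLinearMap

/-- Cycles of `Λ^* nil_n` in degree `k`. -/
noncomputable def Zfull (n : ℕ) (k : ℤ) : Submodule ℤ (C n k) := LinearMap.ker (dFrom n k)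

noncomputable def HnilSub (n : ℕ) (k : ℤ) : Submodule ℤ (Zfull n k) :=
  Submodule.comap (Zfull n k).subtype (LinearMap.range (d n k) ⊓ Zfull n k)

/-- `H_k(nil_n; ℤ)`: the `k`-th integral homology of the Chevalley-Eilenberg complex
of the Lie ring of strictly upper triangular `n × n` integer matrices. -/
noncomputable def Hnil (n : ℕ) (k : ℤ) : Type := Zfull n k ⧸ HnilSub n k

noncomputable instance (n : ℕ) (k : ℤ) : AddCommGroup (Hnil n k) :=
  inferInstanceAs (AddCommGroup (Zfull n k ⧸ HnilSub n k))

noncomputable instance (n : ℕ) (k : ℤ) : Module ℤ (Hnil n k) :=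
  inferInstanceAs (Module ℤ (Zfull n k ⧸ HnilSub n k))

/-- The modified weight of a basis wedge `e_M` (indices of `Fin n` are 0-based, so the
`i`-th weight of the paper, `1 ≤ i ≤ n`, is `wt M ⟨i-1,_⟩`):
`w_i(e_M) = i - #{x : (x,i) ∈ M} + #{y : (i,y) ∈ M}`. -/
def wt {n : ℕ} (M : Finset (P n)) : Fin n → ℤ := fun i =>
  ((i.1 : ℤ) + 1) - (M.filter fun p => p.1.2 = i).card + (M.filter fun p => p.1.1 = i).card

/-- Basis wedges of degree `k` and modified weight `w`. -/
abbrev Bw (n : ℕ) (k : ℤ) (w : Fin n → ℤ) : Type :=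
  {M : Finset (P n) // (M.card : ℤ) = k ∧ wt M = w}

/-- Degree `k` part of the weight summand `⟦w⟧` of `Λ^* nil_n`. -/
abbrev Cw (n : ℕ) (k : ℤ) (w : Fin n → ℤ) : Type := Bw n k w →₀ ℤ

/-- Inclusion of the weight summand. -/
noncomputable def inclW (n : ℕ) (k : ℤ) (w : Fin n → ℤ) : Cw n k w →ₗ[ℤ] C n k :=
  Finsupp.lmapDomain ℤ ℤ fun M => (⟨M.1, M.2.1⟩ : B n k)

/-- Projection onto the weight summand. -/
noncomputable def projW (n : ℕ) (k : ℤ) (w : Fin n → ℤ) : C n k →ₗ[ℤ] Cw n k w :=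
  Finsupp.lsum ℤ fun M =>
    if h : wt M.1 = w then
      LinearMap.toSpanSingleton ℤ (Cw n k w) (Finsupp.single (⟨M.1, M.2, h⟩ : Bw n k w) 1)
    else 0

/-- The boundary of the weight summand `⟦w⟧` (the boundary preserves weights, so this
is the restriction of the Chevalley-Eilenberg boundary). -/
noncomputable def dW (n : ℕ) (k : ℤ) (w : Fin n → ℤ) : Cw n (k + 1) w →ₗ[ℤ] Cw n k w :=
  (projW n k w) ∘ₗ (d n k) ∘ₗ (inclW n (k + 1) w)

noncomputable def castCw (n : ℕ) (w : Fin n → ℤ) {k l : ℤ} (h : k = l) :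
    Cw n k w ≃ₗ[ℤ] Cw n l w :=
  Finsupp.domLCongr (Equiv.subtypeEquivRight fun _ => by rw [h])

noncomputable def dFromW (n : ℕ) (k : ℤ) (w : Fin n → ℤ) : Cw n k w →ₗ[ℤ] Cw n (k - 1) w :=
  (dW n (k - 1) w).comp (castCw n w (by ring : k = k - 1 + 1)).toLinearMap

noncomputable def ZW (n : ℕ) (k : ℤ) (w : Fin n → ℤ) : Submodule ℤ (Cw n k w) :=
  LinearMap.ker (dFromW n k w)

noncomputable def HwSub (n : ℕ) (k : ℤ) (w : Fin n → ℤ) : Submodule ℤ (ZW n k w) :=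
  Submodule.comap (ZW n k w).subtype (LinearMap.range (dW n k w) ⊓ ZW n k w)

/-- `H_k⟦w⟧`: the `k`-th homology of the weight summand `⟦w⟧` of `Λ^* nil_n`. -/
noncomputable def Hw (n : ℕ) (k : ℤ) (w : Fin n → ℤ) : Type := ZW n k w ⧸ HwSub n k w

noncomputable instance (n : ℕ) (k : ℤ) (w : Fin n → ℤ) : AddCommGroup (Hw n k w) :=
  inferInstanceAs (AddCommGroup (ZW n k w ⧸ HwSub n k w))

noncomputable instance (n : ℕ) (k : ℤ) (w : Fin n → ℤ) : Module ℤ (Hw n k w) :=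
  inferInstanceAs (Module ℤ (ZW n k w ⧸ HwSub n k w))

/-- `w ∈ 𝒮_n`: all entries lie in `{1,…,n}` and they add up to `binom (n+1) 2`. -/
def Sn (n : ℕ) (w : Fin n → ℤ) : Prop :=
  (∀ i, 1 ≤ w i ∧ w i ≤ (n : ℤ)) ∧ 2 * ∑ i, w i = (n : ℤ) * ((n : ℤ) + 1)

/-- Number of inversions of a permutation of `Fin n`. -/
def invCount (n : ℕ) (π : Equiv.Perm (Fin n)) : ℕ :=
  (Finset.univ.filter fun p : Fin n × Fin n => p.1 < p.2 ∧ π p.2 < π p.1).card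

/-- The weight sequence `(π(1), …, π(n))` attached to a permutation (1-based values). -/
def permWt (n : ℕ) (π : Equiv.Perm (Fin n)) : Fin n → ℤ := fun i => ((π i).1 : ℤ) + 1

/-- The set of inversions of a permutation, as a set of index pairs. -/
def invFinset {n : ℕ} (π : Equiv.Perm (Fin n)) : Finset (P n) :=
  Finset.univ.filter fun p => π p.1.2 < π p.1.1

/-- Index reversal `i ↦ n+1-i` (0-based: `i ↦ n-1-i`). -/
def rev {n : ℕ} (i : Fin n) : Fin n := ⟨n - 1 - i.1, by have := i.isLt; omega⟩

/-- The index pairs of `nil_8` in lexicographic order. -/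
def pairs : List (P 8) :=
  [⟨(0, 1), by decide⟩, ⟨(0, 2), by decide⟩, ⟨(0, 3), by decide⟩, ⟨(0, 4), by decide⟩,
   ⟨(0, 5), by decide⟩, ⟨(0, 6), by decide⟩, ⟨(0, 7), by decide⟩, ⟨(1, 2), by decide⟩,
   ⟨(1, 3), by decide⟩, ⟨(1, 4), by decide⟩, ⟨(1, 5), by decide⟩, ⟨(1, 6), by decide⟩,
   ⟨(1, 7), by decide⟩, ⟨(2, 3), by decide⟩, ⟨(2, 4), by decide⟩, ⟨(2, 5), by decide⟩,
   ⟨(2, 6), by decide⟩, ⟨(2, 7), by decide⟩, ⟨(3, 4), by decide⟩, ⟨(3, 5), by decide⟩,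
   ⟨(3, 6), by decide⟩, ⟨(3, 7), by decide⟩, ⟨(4, 5), by decide⟩, ⟨(4, 6), by decide⟩,
   ⟨(4, 7), by decide⟩, ⟨(5, 6), by decide⟩, ⟨(5, 7), by decide⟩, ⟨(6, 7), by decide⟩]

/-- The set of pairs whose keys are the set bits of `m`. -/
def decode (m : ℕ) : Finset (P 8) := Finset.univ.filter fun p => m.testBit (key p) = true

/-- The elements of `decode m`, listed in lexicographic order. -/
def support (m : ℕ) : List (P 8) := pairs.filter fun p => m.testBit (key p)

/-- The bit mask of a list of pairs. -/
def encodeList (L : List (P 8)) : ℕ := L.foldr (fun p m => 2 ^ key p ||| m) 0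

/-- The bit mask of a set of pairs. -/
def encode (M : Finset (P 8)) : ℕ := encodeList (pairs.filter (· ∈ M))

/-- The weight of a pair, packed in base `32`. -/
def packedWt (p : P 8) : ℤ := ((32 ^ p.1.1.1 : ℕ) : ℤ) - ((32 ^ p.1.2.1 : ℕ) : ℤ)

/-- Bit masks of the sublists of `L` whose total packed weight is `r`. -/
def search : List (P 8) → ℤ → List ℕ
  | [], r => if r = 0 then [0] else []
  | p :: L, r =>
    if r % ((32 ^ p.1.1.1 : ℕ) : ℤ) = 0 then
      search L r ++ (search L (r - packedWt p)).map (2 ^ key p ||| ·)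
    else []

/-- `pos`, computed on bit masks. -/
def posMask (m t : ℕ) : ℕ := ((support m).filter fun p => Nat.blt (key p) t).length

/-- The contribution of the bracket of `a` and `b` to the boundary of the wedge with mask `m`. -/
def bracketTerm (m : ℕ) (a b : P 8) : List (ℕ × ℤ) :=
  bif Nat.beq a.1.2.1 b.1.1.1 then
    let c := a.1.1.1 * 8 + b.1.2.1
    bif m.testBit c then [] else
      let m' := m ^^^ (2 ^ key a ^^^ (2 ^ key b ^^^ 2 ^ c))
      [(m', bif Nat.beq ((posMask m (key a) + posMask m (key b) + posMask m' c) % 2) 0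
        then 1 else -1)]
  else []

/-- The boundary of the wedge with mask `m`, as a list of masks with coefficients. -/
def bdMask (m : ℕ) : List (ℕ × ℤ) :=
  (support m).flatMap fun a => (support m).flatMap fun b => bracketTerm m a b

/-- Scaling of a formal sum. -/
def smulList (c : ℤ) (l : List (ℕ × ℤ)) : List (ℕ × ℤ) := l.map fun t => (t.1, c * t.2)

/-- Linear extension to formal sums. -/
def extendList (F : ℕ → List (ℕ × ℤ)) (l : List (ℕ × ℤ)) : List (ℕ × ℤ) :=
  l.flatMap fun t => smulList t.2 (F t.1)

/-- Adding a term to a formal sum. -/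
def addTerm (t : ℕ × ℤ) : List (ℕ × ℤ) → List (ℕ × ℤ)
  | [] => [t]
  | s :: l => bif Nat.beq t.1 s.1 then (s.1, t.2 + s.2) :: l else s :: addTerm t l

/-- Collecting like terms of a formal sum and dropping the zero ones. -/
def collect (l : List (ℕ × ℤ)) : List (ℕ × ℤ) := (l.foldr addTerm []).filter fun t => t.2 ≠ 0

/-- Lookup in an association list. -/
def lookupD {α : Type} (z : α) (l : List (ℕ × α)) (m : ℕ) : α :=
  match l with
  | [] => z
  | s :: l => bif Nat.beq m s.1 then s.2 else lookupD z l m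

/-- The weight `(2,4,7,5,4,2,5,7)`. -/
abbrev w₈ : Fin 8 → ℤ := ![2, 4, 7, 5, 4, 2, 5, 7]

set_option maxHeartbeats 4000000 in
/-- Values of a contracting homotopy on the basis wedges of weight `w₈`, with masks sorted into
buckets labelled by their largest element. -/
def homotopyTable : List (ℕ × List (ℕ × List (ℕ × ℤ))) :=
  [(137991577616, [(552624160, [(820535328, -1)]), (820535328, []), (1618518048, [(275691118624,
   1)]), (1622695968, [(275695296544, 1)]), (1625829408, [(139064782864, -1)]), (1626351648,
   [(139064782864, 1), (1894262816, -1)]), (1626874912, [(139333216272, -1), (413137905680, 1),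
   (413137383440, -1), (275699475488, -1), (140399618112, -1), (688007950400, 1)]), (1894262816,
   []), (2692243488, [(138260013064, -1), (138259488784, 1), (139862761504, -1)]), (3765970976,
   [(138252181506, 1), (140399632392, -1), (139325906952, -1), (139333216272, 1), (413137905680,
   -1), (415009091600, 1), (413130072080, 1), (277838571552, -1), (70506996342816, 1),
   (140399618112, 1)]), (137723142176, [(138260013064, 1), (138259488784, -1)]), (137991565376,
   [(140131184704, -1)]), (137991573536, [(138259484704, -1)]), (137991577616, [(138259488784,
   -1)])]), (138260013064, [(137991581698, [(138259492866, 1), (688007950400, 1)]), (138252148864,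
   [(138252181506, -1), (139325906952, 1), (413130072080, -1), (70506996342816, -1)]),
   (138252165184, []), (138252173344, [(139325906952, -1), (413130072080, 1), (70506996342816,
   1)]), (138252181506, []), (138256343104, [(138260522048, -1), (140399618112, -1),
   (688007950400, 1)]), (138258440224, [(138252181506, 1), (138260537348, -1), (139325906952, -1),
   (413130072080, 1), (70506996342816, 1), (138260522048, -1), (140399618112, -1), (688007950400,
   1)]), (138259476544, [(688007950400, 1)]), (138259484704, []), (138259488784, []),
   (138259492866, []), (138259998784, [(140399618112, 1)]), (138260006944, [(139333218312, -1),
   (413137907720, 1), (139333216272, 1), (413137905680, -1), (276769024032, 1), (139330078752,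
   -1), (413671108640, -1), (413134245920, 1), (140399618112, 1), (688007950400, -1)]),
   (138260013064, [])]), (139057471504, [(138260015106, [(139333220354, -1), (413137909762, 1),
   (414207973408, -1)]), (138260522048, []), (138260530208, [(138260538370, 1), (139333220354, 1),
   (413137909762, -1), (414207973408, 1)]), (138260537348, []), (138260538370, []), (138528436256,
   [(139065307144, -1), (140131184704, -1)]), (138789036064, [(139325906952, 1), (413130072080,
   -1)]), (138793213984, [(139333218312, -1), (413137907720, 1), (139333216272, 1), (413137905680,
   -1), (276769024032, 1), (413671108640, -1), (140399618112, 1), (688007950400, -1)]),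
   (138796347424, [(139333218312, 1), (688007950400, 1)]), (138796869664, [(139333740552, 1),
   (139333216272, -1), (140399618112, 1)]), (138797392928, [(138260538370, 2), (139333220354, 2),
   (413137909762, -2), (139325908994, 1), (413130076162, -1), (139334264836, -1), (413138432004,
   1), (139334257696, -1), (413138424864, 1), (414207973408, 1)]), (139057442944, [(138252181506,
   -1), (139325906952, 1), (413130072080, -1), (70506996342816, -1), (139325876352, -1)]),
   (139057467424, [(139325906952, -1), (413130072080, 1), (413130068000, -1), (70506996342816,
   1)]), (139057471504, [(413130072080, -1)])]), (139065831428, [(139057475586, [(413130076162,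
   1), (36028936344840256, -1), (36029210149007424, -1)]), (139061637184, [(138252181506, 1),
   (139325906952, -1), (413130072080, 1), (70506996342816, 1), (36028936076406848, 1),
   (139325876352, 1)]), (139061645344, [(413134245920, -1)]), (139061649424, [(413134250000, -1),
   (138260522048, -1), (140399618112, -1), (688007950400, 1)]), (139061653506, [(413134254082,
   1)]), (139063734304, [(138252181506, 1), (138260537348, -1), (139333740552, -1), (139325906952,
   -1), (139333216272, 1), (413130072080, 1), (139332167712, -1), (70506996342816, 1),
   (138260522048, -1), (140399618112, -2), (688007950400, 1)]), (139064782864, []), (139065301024,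
   [(139333218312, -1), (139333212192, -1), (688007950400, -1)]), (139065305104, [(139333216272,
   -1)]), (139065307144, []), (139065309186, [(139333220354, 1)]), (139065824288, [(138260538370,
   1), (139333220354, 1), (413137909762, -1), (139334264836, -1), (413138432004, 1),
   (413138424864, 1), (36028936344840256, -1), (36029210149007424, -1)]), (139065828368,
   [(139065832450, 1), (138260538370, 1), (413137909762, -1), (413134254082, 1), (413130076162,
   -1), (413138432004, 1), (413138424864, 1)]), (139065831428, [(139334264836, 1)])]),
   (139333220354, [(139065832450, []), (139325876352, []), (139325900832, [(139325908994, 1),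
   (413130076162, -1), (36028936344840256, 1), (36029210149007424, 1)]), (139325906952, []),
   (139325908994, []), (139330070592, []), (139330078752, []), (139330084872, [(414207979528, 1),
   (414207977488, -1)]), (139330086914, [(414207981570, -1)]), (139332167712, []), (139333212192,
   []), (139333216272, []), (139333218312, []), (139333220354, [])]), (140399634434,
   [(139333740552, []), (139334257696, []), (139334263816, [(139334265858, 1), (414207981570,
   -1)]), (139334264836, []), (139334265858, []), (139862761504, []), (140131184704, []),
   (140131192864, [(139333218312, -1), (413137907720, 1), (139325906952, -1), (139333216272, 1),
   (413137905680, -1), (413130072080, 1), (276769024032, 1), (140399626272, -1), (139330078752,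
   -1), (413671108640, -1), (413134245920, 1), (70506996342816, 1), (140399618112, 1),
   (688007950400, -1)]), (140131196944, [(138252181506, 1), (140399632392, -1), (139325906952,
   -1), (413130072080, 1), (70506996342816, 1)]), (140131201026, [(139333220354, -1),
   (413137909762, 1), (140399634434, 1), (414207973408, -1)]), (140399618112, []), (140399626272,
   []), (140399632392, []), (140399634434, [])]), (276500590624, [(140668055584, [(138252181506,
   1), (141204926472, -1), (139325906952, -1), (413130072080, 1), (70506996342816, 1),
   (139325876352, 1)]), (140936488992, [(141473359880, 1), (415277525008, 1)]), (141204920352,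
   [(141204928514, -1), (413137909762, -1), (140399634434, -1), (413130076162, 1), (415277525008,
   1), (414207973408, 1), (36028936344840256, -1), (36029210149007424, -1)]), (141204924432,
   [(415277525008, 1)]), (141204926472, []), (141204928514, []), (141473359880, []),
   (275430518816, [(139065307144, -1), (138260013064, -1), (138259488784, 1), (412601036832, 1),
   (140131184704, -1)]), (275691118624, []), (275695296544, []), (275698429984, [(413137907720,
   1), (413137383440, -1), (688007950400, 1)]), (275698952224, [(413137907720, 1), (139333216272,
   1), (413137905680, -1), (140399618112, 1)]), (275699475488, []), (276500590624, [(413137907720,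
   -1), (139333216272, -1), (413137905680, 1), (276769024032, -1), (140399618112, -1)])]),
   (413136334880, [(276769024032, []), (277570138144, [(138252181506, -1), (413137907720, 1),
   (140399632392, 1), (139325906952, 1), (415009091600, -1), (413130072080, -1), (70506996342816,
   -1)]), (277838571552, []), (412601036832, []), (412869472272, [(413137907720, -1)]),
   (413130043520, [(36028936344840256, -1), (36029210149007424, -1)]), (413130068000, []),
   (413130072080, []), (413130076162, []), (413134237760, []), (413134245920, []), (413134250000,
   []), (413134254082, []), (413136334880, [(139334264836, 1), (413138432004, -1),
   (36028936344840256, 1), (36029210149007424, 1)])]), (414207979528, [(413137383440, []),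
   (413137901600, [(414207973408, -1)]), (413137905680, []), (413137907720, []), (413137909762,
   []), (413138424864, []), (413138428944, [(413138433026, 1)]), (413138432004, []),
   (413138433026, []), (413671108640, []), (413939544080, [(414207977488, -1)]), (414207973408,
   []), (414207977488, []), (414207979528, [])]), (688007966722, [(414207981570, []),
   (414740656160, [(415277527048, 1), (36028936344840256, -1), (36029210149007424, -1)]),
   (415009091600, []), (415277520928, [(415277529090, -1)]), (415277525008, []), (415277527048,
   []), (415277529090, []), (550569009184, [(139333218312, 1), (413137907720, -1), (139325906952,
   2), (139333216272, -1), (413137905680, 1), (413130072080, -2), (276769024032, -1),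
   (140399626272, 1), (139330078752, 1), (413671108640, 1), (688007958560, -1), (413134245920,
   -1), (70506996342816, -2), (140399618112, -1), (688007950400, 1)]), (551374303264,
   [(138252181506, -1), (139325906952, 1), (688813256720, -1), (70506996342816, -1),
   (139325876352, -1)]), (551642736672, [(139325908994, 1), (413130076162, -1), (414207979528,
   -1), (36028936344854536, -1), (36029210954313744, 1), (36029073783793696, -1),
   (36028936344848416, 1), (36029210149015584, -1), (36029210149007424, 1)]), (688007950400, []),
   (688007958560, []), (688007962640, [(139325908994, -1), (413130076162, 1), (414207979528, 1),
   (36028936344854536, 1), (414207977488, -1), (36029210149019664, -1), (36028936344848416, -1),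
   (36029210149015584, 1), (36028936344840256, 1), (36029210149007424, -1)]), (688007966722,
   [(414207981570, -1), (36028936344856578, -1), (36029210149023746, 1)])]), (70507004699680,
   [(688544821280, [(689081692168, 1)]), (688813256720, []), (689081686048, [(415277529090, 1),
   (36029211222749192, 1), (36029211222743072, 1)]), (689081690128, [(36029211222747152, 1)]),
   (689081692168, []), (689081694210, [(36029211222751234, -1)]), (825446903840, [(139325908994,
   1), (413130076162, -1), (414207979528, -1), (36028936344854536, -1), (414207977488, 1),
   (962885857296, -1), (36029210149019664, 1), (36028936344848416, 1), (36029210149015584, -1),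
   (36029210149007424, 2)]), (962885857296, []), (70506735743008, [(139333740552, 1),
   (139333218312, -1), (413137907720, 2), (139333216272, 1), (413137905680, -2), (276769024032,
   1), (70507004176416, -1), (139330078752, -1), (413671108640, -1), (413134245920, 1),
   (140399618112, 4), (688007950400, -1)]), (70506996342816, []), (70507000520736, [(138260538370,
   -3), (139333220354, -3), (413137909762, 3), (139334264836, 1), (413138432004, -1),
   (141473359880, -1), (689081692168, 1), (414207979528, -1), (36028936344854536, -1),
   (415277525008, -1), (414207977488, 1), (962885857296, -1), (36029210149019664, 1),
   (139334257696, 1), (413138424864, -1), (70507004699680, -1), (414207973408, -2),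
   (70509143795744, -1), (36028936344848416, 1), (71056752128032, 1), (36029210149015584, -1),
   (36029210149007424, 2)]), (70507003654176, [(139325908994, 1), (413130076162, -1),
   (141473359880, -1), (689081692168, 1), (414207979528, -1), (36028936344854536, -1),
   (415277525008, -1), (414207977488, 1), (962885857296, -1), (36029210149019664, 1),
   (70509143795744, -1), (36028936344848416, 1), (71056752128032, 1), (36029210149015584, -1),
   (36029210149007424, 2)]), (70507004176416, []), (70507004699680, [])]), (36028936076406848,
   [(70507805814816, [(138260538370, -3), (139333220354, -3), (413137909762, 3), (139334264836,
   1), (413138432004, -1), (141473359880, -1), (689081692168, 1), (414207979528, -1),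
   (36028936344854536, -1), (415277525008, -1), (414207977488, 1), (962885857296, -1),
   (36029210149019664, 1), (139334257696, 1), (413138424864, -1), (70507004699680, -1),
   (414207973408, -2), (70509143795744, -1), (70508074248224, -1), (36028936344848416, 1),
   (71056752128032, 1), (36029210149015584, -1), (36029210149007424, 2)]), (70508074248224, []),
   (70508875362336, [(141473359880, -1), (415277525008, -1), (70509143795744, -1)]),
   (70509143795744, []), (70781878415392, []), (71056752128032, []), (140875740504096,
   [(138260538370, 3), (139333220354, 3), (413137909762, -3), (139325908994, 1), (413130076162,
   -1), (139334264836, -1), (413138432004, 1), (141473359880, 1), (689081692168, -1),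
   (414207979528, 1), (36028936344854536, 1), (415277525008, 1), (414207977488, -1),
   (962885857296, 1), (36029210149019664, -1), (139334257696, -1), (413138424864, 1),
   (70507004699680, 1), (414207973408, 2), (140876814231584, 1), (36029073783793696, -1),
   (70509143795744, 2), (70508074248224, 1), (36028936344848416, -1), (71056752128032, -1),
   (36099304820584480, -1), (36028936344840256, 1), (36029210149007424, -1)]), (140876545798176,
   [(138260538370, 3), (139333220354, 3), (413137909762, -3), (139325908994, -1), (413130076162,
   1), (139334264836, -1), (413138432004, 1), (141473359880, 2), (689081692168, -1),
   (414207979528, 2), (36028936344854536, 2), (415277525008, 2), (414207977488, -1),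
   (962885857296, 1), (36029210954313744, -1), (36029210149019664, -1), (139334257696, -1),
   (413138424864, 1), (70507004699680, 1), (414207973408, 2), (70509143795744, 2),
   (70508074248224, 1), (36028936344848416, -2), (71056752128032, -1), (36099304820584480, -1),
   (36029210149015584, 1), (36029210149007424, -3)]), (140876814231584, []), (141150618398752,
   [(36029211222749192, 1), (36099305089017888, 1), (36099578893185056, 1)]), (36028798637465632,
   [(139333218312, -1), (413137907720, 1), (139325906952, -2), (139333216272, 1), (413137905680,
   -1), (413130072080, 2), (276769024032, 1), (140399626272, -1), (139330078752, -1),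
   (413671108640, -1), (688007958560, 1), (413134245920, 1), (36029072710066208, 1),
   (70506996342816, 2), (140399618112, 1), (688007950400, -1)]), (36028935271112768,
   [(36028936344840256, 1)]), (36028935807983648, [(139325908994, 1), (413130076162, -1),
   (36028936344848416, 1), (36029210149015584, -1), (36028936344840256, 1), (36029210149007424,
   1)]), (36028936076406848, [])]), (36029210149023746, [(36028936076415008, [(36029210149015584,
   -1)]), (36028936076419088, [(139325908994, 1), (413130076162, -1), (414207979528, -1),
   (36028936344854536, -1), (414207977488, 1), (36028936344848416, 1), (36029210149015584, -1),
   (36029210149007424, 1)]), (36028936076423170, [(414207981570, 1), (36028936344856578, 1)]),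
   (36028936344840256, []), (36028936344848416, []), (36028936344854536, []), (36028936344856578,
   []), (36029072710066208, []), (36029073515360288, [(139325908994, -1), (413130076162, 1),
   (414207979528, 1), (36028936344854536, 1), (36029210954313744, -1), (36028936344848416, -1),
   (36029210149015584, 1), (36029210149007424, -1)]), (36029073783793696, []), (36029210149007424,
   []), (36029210149015584, []), (36029210149019664, []), (36029210149023746, [])]),
   (36099578893185056, [(36029210685878304, [(36029211222749192, 1)]), (36029210954313744, []),
   (36029211222743072, []), (36029211222747152, []), (36029211222749192, []), (36029211222751234,
   []), (36099304015290400, [(36099305089017888, 1)]), (36099304820584480, []),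
   (36099305089017888, []), (36099578893185056, [])])]

/-- A generator of the reduced complex in degree `12`. -/
def gen12 : List (ℕ × ℤ) :=
  [(138260538370, -6), (139333220354, -6), (413137909762, 6), (139325908994, 1), (413130076162,
   -1), (139334264836, 3), (413138432004, -3), (141473359880, -3), (689081692168, 3),
   (414207979528, -3), (36028936344854536, -3), (415277525008, -3), (414207977488, 3),
   (962885857296, -3), (36029210149019664, 3), (139334257696, 2), (413138424864, -2),
   (70507004699680, -2), (414207973408, -4), (70509143795744, -3), (70508074248224, -1),
   (36028936344848416, 3), (71056752128032, 3), (70781878415392, 1), (36029210149015584, -3),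
   (36028936344840256, 1), (36029210149007424, 7)]

/-- The coordinate along `gen12`. -/
def coord12 : List (ℕ × ℤ) :=
  [(141150618398752, -1), (70781878415392, 1)]

/-- A generator of the reduced complex in degree `11`; eight times it is the boundary of
`gen12`. -/
def gen11 : List (ℕ × ℤ) :=
  [(138252181506, -1), (139325906952, 1), (413130072080, -1), (70506996342816, -1), (138260522048,
   1), (140399618112, 1), (688007950400, -2), (36028936076406848, -1), (413134237760, -1),
   (139325876352, -1)]

/-- The coordinate along `gen11`. -/
def coord11 : List (ℕ × ℤ) :=
  [(139061653506, -1), (139057475586, 1), (139330084872, -1), (139065824288, 2), (138797392928,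
   1), (141204920352, 1), (139325900832, -1), (825446903840, -1), (414740656160, 1),
   (140876545798176, 2), (70507805814816, -2), (413136334880, -2), (70507003654176, -1),
   (140875740504096, 1), (36028935807983648, -1), (70507000520736, -2), (413134237760, -1),
   (413130043520, 1)]

/-- A generator of the reduced complex in degree `11`; its boundary is eight times `gen10`. -/
def gen11b : List (ℕ × ℤ) :=
  [(138252181506, 1), (139325906952, -1), (413130072080, 1), (70506996342816, 1), (138260522048,
   1), (140399618112, 2), (139330070592, 1), (688007950400, -1), (36028936076406848, 1),
   (139325876352, 1)]

/-- The coordinate along `gen11b`. -/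
def coord11b : List (ℕ × ℤ) :=
  [(139057475586, -1), (139065831428, -1), (139330084872, -1), (413939544080, -1),
   (36028936076419088, 1), (138797392928, 1), (141204920352, -1), (139325900832, 1),
   (825446903840, 1), (414740656160, -1), (140876545798176, 1), (70507805814816, -1),
   (70507003654176, 1), (140875740504096, 2), (36028935807983648, 1), (139330070592, 1),
   (36028935271112768, 1), (413130043520, -1)]

/-- A generator of the reduced complex in degree `10`. -/
def gen10 : List (ℕ × ℤ) :=
  [(138252165184, 1)]

/-- The coordinate along `gen10`. -/
def coord10 : List (ℕ × ℤ) :=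
  [(137991581698, 1), (140131196944, -4), (139061649424, 3), (139057471504, 1), (1626874912, 2),
   (139065301024, -1), (3765970976, -5), (275698952224, -1), (138796869664, -1), (138260006944,
   -2), (551374303264, 3), (277570138144, 4), (140668055584, -4), (276500590624, 1),
   (275698429984, 1), (138796347424, 1), (70506735743008, -5), (140131192864, -5), (139057467424,
   -3), (550569009184, 8), (36028798637465632, -8), (138793213984, -2), (138258440224, -1),
   (138789036064, 2), (138252173344, -3), (138259998784, -1), (139061637184, -4), (138259476544,
   1), (138256343104, 3), (138252165184, 1), (139057442944, 4), (138252148864, 4)]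

/-- The masks of the basis wedges of weight `w₈`. -/
def masks : List ℕ := homotopyTable.flatMap fun b => b.2.map Prod.fst

/-- The first bucket whose label is at least `m`. -/
def bucket {α : Type} (m : ℕ) : List (ℕ × List α) → List α
  | [] => []
  | b :: l => bif Nat.ble m b.1 then b.2 else bucket m l

/-- The contracting homotopy on a mask. -/
def hMask (m : ℕ) : List (ℕ × ℤ) := lookupD [] (bucket m homotopyTable) m

/-- The projection onto the reduced complex, on a mask. -/
def prMask (m : ℕ) : List (ℕ × ℤ) :=
  smulList (lookupD 0 coord12 m) gen12 ++ (smulList (lookupD 0 coord11 m) gen11 ++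
    (smulList (lookupD 0 coord11b m) gen11b ++ smulList (lookupD 0 coord10 m) gen10))

/-- Pairing of a functional with a formal sum. -/
def pairing (F : ℕ → ℤ) (l : List (ℕ × ℤ)) : ℤ := (l.map fun t => t.2 * F t.1).sum

theorem search_masks : ∀ m ∈ search pairs (-36642451391), m ∈ masks := by
  decide +kernel

theorem masks_check : ∀ m ∈ masks,
    collect (prMask m ++ (extendList bdMask (hMask m) ++ extendList hMask (bdMask m))) =
      [(m, 1)] ∧
    (∀ t ∈ bdMask m, encodeList (support t.1) = t.1) ∧
    pairing (lookupD 0 coord10) (bdMask m) = 8 * lookupD 0 coord11b m ∧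
    pairing (lookupD 0 coord11) (bdMask m) = 8 * lookupD 0 coord12 m := by
  decide +kernel

theorem gen_check : collect (extendList bdMask gen12 ++ smulList (-8) gen11) = [] ∧
    collect (extendList bdMask gen11) = [] ∧
    collect (extendList bdMask gen11b ++ smulList (-8) gen10) = [] ∧
    collect (extendList bdMask gen10) = [] ∧
    pairing (lookupD 0 coord11) gen11 = 1 ∧ pairing (lookupD 0 coord10) gen10 = 1 := by
  decide +kernel

theorem gen_wt :
    (∀ t ∈ gen11, (support t.1).length = 11 ∧ encodeList (support t.1) = t.1 ∧
      wt (decode t.1) = w₈) ∧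
    (∀ t ∈ gen10, (support t.1).length = 10 ∧ encodeList (support t.1) = t.1 ∧
      wt (decode t.1) = w₈) := by
  decide +kernel

theorem key_injective : Function.Injective (key : P 8 → ℕ) := by
  intro p q h
  have h1 := p.1.1.2
  have h2 := p.1.2.2
  have h3 := q.1.1.2
  have h4 := q.1.2.2
  simp only [key] at h
  exact Subtype.ext (Prod.ext (Fin.ext (by omega)) (Fin.ext (by omega)))

theorem mem_pairs : ∀ p : P 8, p ∈ pairs := by decide +kernel

theorem nodup_pairs : pairs.Nodup := by decide +kernel

theorem pairwise_pairs : pairs.Pairwise fun p q => p.1.1.1 ≤ q.1.1.1 := by decide +kernel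

theorem mem_decode {m : ℕ} {p : P 8} : p ∈ decode m ↔ m.testBit (key p) = true := by
  simp [decode]

theorem mem_support {m : ℕ} {p : P 8} : p ∈ support m ↔ p ∈ decode m := by
  simp [support, mem_decode, mem_pairs]

theorem decode_eq_toFinset (m : ℕ) : decode m = (support m).toFinset := by
  ext p
  simp [mem_support]

theorem nodup_support (m : ℕ) : (support m).Nodup := nodup_pairs.filter _

theorem sum_decode {A : Type*} [AddCommMonoid A] (m : ℕ) (F : P 8 → A) :
    ∑ a ∈ decode m, F a = ((support m).map F).sum := by
  rw [decode_eq_toFinset, List.sum_toFinset _ (nodup_support m)]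

theorem card_decode (m : ℕ) : (decode m).card = (support m).length := by
  rw [decode_eq_toFinset, List.toFinset_card_of_nodup (nodup_support m)]

theorem posMask_key (m : ℕ) (a : P 8) : posMask m (key a) = pos (decode m) a := by
  have h : (decode m).filter (fun b => key b < key a) =
      ((support m).filter fun p => Nat.blt (key p) (key a)).toFinset := by
    ext p
    simp [mem_support, Nat.blt_eq]
  rw [pos, h, List.toFinset_card_of_nodup ((nodup_support m).filter _), posMask]

theorem testBit_encodeList (L : List (P 8)) (p : P 8) :
    (encodeList L).testBit (key p) = true ↔ p ∈ L := by
  induction L with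
  | nil => simp [encodeList]
  | cons q L ih =>
    have : encodeList (q :: L) = 2 ^ key q ||| encodeList L := rfl
    rw [this, Nat.testBit_or, Bool.or_eq_true, ih, Nat.testBit_two_pow, decide_eq_true_iff,
      key_injective.eq_iff, List.mem_cons, eq_comm]

theorem decode_encode (M : Finset (P 8)) : decode (encode M) = M := by
  ext p
  simp [mem_decode, encode, testBit_encodeList, mem_pairs]

theorem encode_decode (m : ℕ) : encode (decode m) = encodeList (support m) := by
  simp [encode, support, mem_decode]

theorem wt_eq_sum {n : ℕ} (M : Finset (P n)) (i : Fin n) :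
    wt M i = ((i.1 : ℤ) + 1) +
      ∑ p ∈ M, ((if p.1.1 = i then 1 else 0) - (if p.1.2 = i then 1 else 0) : ℤ) := by
  simp only [wt, Finset.sum_sub_distrib, Finset.card_filter]
  push_cast
  ring

theorem sum_packedWt (M : Finset (P 8)) (hM : wt M = w₈) :
    ∑ p ∈ M, packedWt p = -36642451391 := by
  have h1 : ∑ p ∈ M, packedWt p = ∑ i : Fin 8, (32 : ℤ) ^ i.1 * (wt M i - ((i.1 : ℤ) + 1)) := by
    simp only [wt_eq_sum, add_sub_cancel_left, Finset.mul_sum]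
    rw [Finset.sum_comm]
    refine Finset.sum_congr rfl fun p _ => ?_
    simp [mul_sub, Finset.sum_sub_distrib, packedWt]
  rw [h1, hM]
  decide +kernel

theorem encodeList_mem_search (L : List (P 8)) (hL : L.Pairwise fun p q => p.1.1.1 ≤ q.1.1.1)
    (M : Finset (P 8)) (r : ℤ) (hr : ((L.filter (· ∈ M)).map packedWt).sum = r) :
    encodeList (L.filter (· ∈ M)) ∈ search L r := by
  induction L generalizing r with
  | nil =>
    simp only [List.filter_nil, List.map_nil, List.sum_nil] at hr
    simp [search, ← hr, encodeList]
  | cons p L ih =>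
    have hdvd : ((32 ^ p.1.1.1 : ℕ) : ℤ) ∣ r := by
      rw [← hr]
      refine List.dvd_sum fun x hx => ?_
      obtain ⟨q, hq, rfl⟩ := List.mem_map.1 hx
      have h1 : p.1.1.1 ≤ q.1.1.1 := by
        rcases List.mem_cons.1 (List.mem_filter.1 hq).1 with rfl | h
        · exact le_rfl
        · exact (List.pairwise_cons.1 hL).1 q h
      have h2 : q.1.1.1 < q.1.2.1 := q.2
      exact dvd_sub (Int.natCast_dvd_natCast.2 (pow_dvd_pow _ h1))
        (Int.natCast_dvd_natCast.2 (pow_dvd_pow _ (h1.trans h2.le)))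
    rw [search, if_pos (Int.emod_eq_zero_of_dvd hdvd), List.mem_append]
    have ih' := ih (List.pairwise_cons.1 hL).2
    by_cases hp : p ∈ M
    · right
      rw [List.filter_cons_of_pos (by simpa using hp)] at hr ⊢
      refine List.mem_map.2 ⟨_, ih' _ ?_, rfl⟩
      rw [List.map_cons, List.sum_cons] at hr
      linarith
    · left
      rw [List.filter_cons_of_neg (by simpa using hp)] at hr ⊢
      exact ih' _ hr

theorem encode_mem_masks {M : Finset (P 8)} (hM : wt M = w₈) : encode M ∈ masks := by
  refine search_masks _ (encodeList_mem_search _ pairwise_pairs M _ ?_)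
  rw [← sum_packedWt M hM, ← List.sum_toFinset _ (nodup_pairs.filter _)]
  exact Finset.sum_congr (by ext p; simp [mem_pairs]) fun _ _ => rfl

section Bracket

variable {n : ℕ} {M : Finset (P n)} {a b c : P n}

theorem wt_bracket (ha : a ∈ M) (hb : b ∈ M) (hab : a.1.2 = b.1.1) (hc : c.1 = (a.1.1, b.1.2))
    (hcM : c ∉ M) : wt (insert c ((M.erase a).erase b)) = wt M := by
  have hne : b ≠ a := by
    rintro rfl
    exact absurd b.2 (by rw [hab]; exact lt_irrefl _)
  funext i
  rw [wt_eq_sum, wt_eq_sum, Finset.sum_insert (by simp [hcM]),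
    ← Finset.add_sum_erase M _ ha, ← Finset.add_sum_erase (M.erase a) _
      (Finset.mem_erase.2 ⟨hne, hb⟩), hc, hab]
  ring

theorem card_bracket (ha : a ∈ M) (hb : b ∈ M) (hab : a.1.2 = b.1.1) (hcM : c ∉ M) :
    (insert c ((M.erase a).erase b)).card + 1 = M.card := by
  have hne : b ≠ a := by
    rintro rfl
    exact absurd b.2 (by rw [hab]; exact lt_irrefl _)
  have hb' : b ∈ M.erase a := Finset.mem_erase.2 ⟨hne, hb⟩
  rw [Finset.card_insert_of_notMem (by simp [hcM]), Finset.card_erase_add_one hb',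
    Finset.card_erase_add_one ha]

theorem card_bracket_of_mem (ha : a ∈ M) (hb : b ∈ M) (hab : a.1.2 = b.1.1)
    (hc : c.1 = (a.1.1, b.1.2)) (hcM : c ∈ M) :
    (insert c ((M.erase a).erase b)).card + 2 = M.card := by
  have hne : b ≠ a := by
    rintro rfl
    exact absurd b.2 (by rw [hab]; exact lt_irrefl _)
  have hca : c ≠ a := by
    rintro rfl
    have : c.1.2 = b.1.2 := by rw [hc]
    exact absurd b.2 (by rw [← hab, this]; exact lt_irrefl _)
  have hcb : c ≠ b := by
    rintro rfl
    have : c.1.1 = a.1.1 := by rw [hc]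
    exact absurd a.2 (by rw [hab, this]; exact lt_irrefl _)
  have hb' : b ∈ M.erase a := Finset.mem_erase.2 ⟨hne, hb⟩
  rw [Finset.insert_eq_of_mem (by simp [hca, hcb, hcM])]
  have h1 := Finset.card_erase_add_one hb'
  have h2 := Finset.card_erase_add_one ha
  omega

end Bracket

/-- The basis element of `⟦w⟧` in degree `k` with mask `m`, or `0` if there is none. -/
noncomputable def bas (k : ℤ) (w : Fin 8 → ℤ) (m : ℕ) : Cw 8 k w :=
  if h : ((decode m).card : ℤ) = k ∧ wt (decode m) = w then
    Finsupp.single (⟨decode m, h⟩ : Bw 8 k w) 1 else 0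

/-- The chain represented by a formal sum of masks. -/
noncomputable def ofList (k : ℤ) (w : Fin 8 → ℤ) (l : List (ℕ × ℤ)) : Cw 8 k w :=
  (l.map fun t => t.2 • bas k w t.1).sum

theorem ofList_append (k : ℤ) (w : Fin 8 → ℤ) (l l' : List (ℕ × ℤ)) :
    ofList k w (l ++ l') = ofList k w l + ofList k w l' := by
  simp [ofList]

theorem ofList_cons (k : ℤ) (w : Fin 8 → ℤ) (t : ℕ × ℤ) (l : List (ℕ × ℤ)) :
    ofList k w (t :: l) = t.2 • bas k w t.1 + ofList k w l := by
  simp [ofList]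

theorem ofList_nil (k : ℤ) (w : Fin 8 → ℤ) : ofList k w [] = 0 := rfl

theorem ofList_smulList (k : ℤ) (w : Fin 8 → ℤ) (c : ℤ) (l : List (ℕ × ℤ)) :
    ofList k w (smulList c l) = c • ofList k w l := by
  simp [ofList, smulList, List.smul_sum, Function.comp_def, mul_smul]

theorem ofList_flatMap {α : Type*} (k : ℤ) (w : Fin 8 → ℤ) (l : List α) (F : α → List (ℕ × ℤ)) :
    ofList k w (l.flatMap F) = (l.map fun x => ofList k w (F x)).sum := by
  induction l with
  | nil => simp [ofList]
  | cons x l ih => simp [ofList_append, ih]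

theorem ofList_addTerm (k : ℤ) (w : Fin 8 → ℤ) (t : ℕ × ℤ) (l : List (ℕ × ℤ)) :
    ofList k w (addTerm t l) = ofList k w (t :: l) := by
  induction l with
  | nil => rfl
  | cons s l ih =>
    rw [addTerm]
    cases h : Nat.beq t.1 s.1 with
    | true =>
      have h' : t.1 = s.1 := Nat.eq_of_beq_eq_true h
      simp [ofList_cons, h', add_smul, add_assoc]
    | false =>
      simp [ofList_cons, ih, add_left_comm]

theorem ofList_collect (k : ℤ) (w : Fin 8 → ℤ) (l : List (ℕ × ℤ)) :
    ofList k w (collect l) = ofList k w l := by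
  have h1 : ∀ l : List (ℕ × ℤ), ofList k w (l.filter fun t => t.2 ≠ 0) = ofList k w l := by
    intro l
    induction l with
    | nil => rfl
    | cons t l ih =>
      by_cases ht : t.2 = 0
      · simpa [ofList_cons, ht] using ih
      · rw [List.filter_cons_of_pos (by simpa using ht), ofList_cons, ofList_cons, ih]
  rw [collect, h1]
  induction l with
  | nil => rfl
  | cons t l ih => rw [List.foldr_cons, ofList_addTerm, ofList_cons, ofList_cons, ih]

theorem projW_single (n : ℕ) (k : ℤ) (w : Fin n → ℤ) (M : B n k) :
    projW n k w (Finsupp.single M 1) =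
      if h : wt M.1 = w then Finsupp.single (⟨M.1, M.2, h⟩ : Bw n k w) 1 else 0 := by
  rw [projW, Finsupp.lsum_single]
  split_ifs <;> simp

theorem inclW_single (n : ℕ) (k : ℤ) (w : Fin n → ℤ) (M : Bw n k w) :
    inclW n k w (Finsupp.single M 1) = Finsupp.single (⟨M.1, M.2.1⟩ : B n k) 1 := by
  simp [inclW]

theorem d_single (n : ℕ) (k : ℤ) (M : B n (k + 1)) :
    d n k (Finsupp.single M 1) = dAux k M.1 := by
  simp [d]

theorem dW_single (n : ℕ) (k : ℤ) (w : Fin n → ℤ) (M : Bw n (k + 1) w) :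
    dW n k w (Finsupp.single M 1) = projW n k w (dAux k M.1) := by
  simp [dW, inclW_single, d_single]

theorem decode_bracket {m : ℕ} {a b c : P 8} (ha : a ∈ decode m) (hb : b ∈ decode m)
    (hab : a.1.2 = b.1.1) (hcM : c ∉ decode m) :
    decode (m ^^^ (2 ^ key a ^^^ (2 ^ key b ^^^ 2 ^ key c))) =
      insert c (((decode m).erase a).erase b) := by
  have hne : b ≠ a := by
    rintro rfl
    exact absurd b.2 (by rw [hab]; exact lt_irrefl _)
  have hca : c ≠ a := fun h => hcM (h ▸ ha)
  have hcb : c ≠ b := fun h => hcM (h ▸ hb)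
  ext p
  rw [mem_decode]
  simp only [Nat.testBit_xor, Nat.testBit_two_pow, key_injective.eq_iff, Finset.mem_insert,
    Finset.mem_erase]
  rw [mem_decode] at ha hb hcM
  by_cases h1 : p = a
  · subst h1
    simp [ha, hne, hca, hca.symm]
  by_cases h2 : p = b
  · subst h2
    simp [hb, hne.symm, hcb, hcb.symm]
  by_cases h3 : p = c
  · subst h3
    simp [hcM, hca.symm, hcb.symm]
  · simp [h1, h2, h3, Ne.symm h1, Ne.symm h2, Ne.symm h3, mem_decode]

theorem ofList_bracketTerm (k : ℤ) (w : Fin 8 → ℤ) {m : ℕ} {a b : P 8} (ha : a ∈ decode m)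
    (hb : b ∈ decode m) (hm : ((decode m).card : ℤ) = k + 1) :
    ofList k w (bracketTerm m a b) = projW 8 k w
      (if hab : a.1.2 = b.1.1 then
        (let c : P 8 := ⟨(a.1.1, b.1.2), lt_trans a.2 (by rw [hab]; exact b.2)⟩
         let M' : Finset (P 8) := insert c (((decode m).erase a).erase b)
         if h' : (M'.card : ℤ) = k then
           ((-1 : ℤ) ^ (pos (decode m) a + pos (decode m) b + pos M' c)) •
             Finsupp.single (⟨M', h'⟩ : B 8 k) 1
         else 0)
      else 0) := by
  by_cases hab : a.1.2 = b.1.1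
  · rw [dif_pos hab]
    obtain ⟨c, hc⟩ : ∃ c : P 8, c = ⟨(a.1.1, b.1.2), lt_trans a.2 (by rw [hab]; exact b.2)⟩ :=
      ⟨_, rfl⟩
    have hc' : c.1 = (a.1.1, b.1.2) := by rw [hc]
    have hkey : a.1.1.1 * 8 + b.1.2.1 = key c := by rw [hc]; rfl
    have hbeq : Nat.beq a.1.2.1 b.1.1.1 = true := by rw [hab]; exact Nat.beq_refl _
    simp only [← hc, bracketTerm, hbeq, hkey, cond_true]
    by_cases hcM : c ∈ decode m
    · have := card_bracket_of_mem ha hb hab hc' hcM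
      rw [dif_neg (by omega), mem_decode.1 hcM]
      simp [ofList]
    · have hcard := card_bracket ha hb hab hcM
      have hcM' : m.testBit (key c) = false := by
        simpa [mem_decode] using hcM
      have hdec := decode_bracket ha hb hab hcM
      rw [dif_pos (by omega), hcM', cond_false, posMask_key, posMask_key, posMask_key, map_smul,
        projW_single]
      simp only [ofList_cons, ofList_nil, add_zero, bas, hdec]
      congr 1
      · cases h : Nat.beq ((pos (decode m) a + pos (decode m) b +
            pos (insert c (((decode m).erase a).erase b)) c) % 2) 0 with
        | true =>
          rw [cond_true, Even.neg_one_pow (Nat.even_iff.2 (Nat.eq_of_beq_eq_true h))]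
        | false =>
          rw [cond_false, Odd.neg_one_pow (Nat.odd_iff.2 ?_)]
          exact Nat.mod_two_ne_zero.1 (Nat.ne_of_beq_eq_false h)
      · by_cases hw : wt (insert c (((decode m).erase a).erase b)) = w
        · rw [dif_pos ⟨by omega, hw⟩, dif_pos hw]
        · rw [dif_neg (fun h => hw h.2), dif_neg hw]
  · have hbeq : Nat.beq a.1.2.1 b.1.1.1 = false :=
      Bool.eq_false_iff.2 fun h => hab (Fin.ext (Nat.eq_of_beq_eq_true h))
    rw [dif_neg hab, bracketTerm, hbeq]
    simp [ofList]

theorem ofList_bdMask (k : ℤ) (w : Fin 8 → ℤ) {m : ℕ} (hm : ((decode m).card : ℤ) = k + 1) :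
    ofList k w (bdMask m) = projW 8 k w (dAux k (decode m)) := by
  simp only [bdMask, ofList_flatMap, ← sum_decode, dAux, map_sum]
  exact Finset.sum_congr rfl fun a ha => Finset.sum_congr rfl fun b hb =>
    ofList_bracketTerm k w ha hb hm

theorem wt_card_of_mem_bdMask {m : ℕ} {t : ℕ × ℤ} (ht : t ∈ bdMask m) :
    wt (decode t.1) = wt (decode m) ∧ (decode t.1).card + 1 = (decode m).card := by
  simp only [bdMask, List.mem_flatMap, mem_support] at ht
  obtain ⟨a, ha, b, hb, ht⟩ := ht
  cases hbeq : Nat.beq a.1.2.1 b.1.1.1 with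
  | false => simp [bracketTerm, hbeq] at ht
  | true =>
    have hab : a.1.2 = b.1.1 := Fin.ext (Nat.eq_of_beq_eq_true hbeq)
    obtain ⟨c, hc⟩ : ∃ c : P 8, c = ⟨(a.1.1, b.1.2), lt_trans a.2 (by rw [hab]; exact b.2)⟩ :=
      ⟨_, rfl⟩
    have hc' : c.1 = (a.1.1, b.1.2) := by rw [hc]
    have hkey : a.1.1.1 * 8 + b.1.2.1 = key c := by rw [hc]; rfl
    simp only [bracketTerm, hbeq, hkey, cond_true] at ht
    cases hcM : m.testBit (key c) with
    | true => simp [hcM] at ht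
    | false =>
      have hcM' : c ∉ decode m := by simp [mem_decode, hcM]
      rw [hcM, cond_false, List.mem_singleton] at ht
      rw [ht, decode_bracket ha hb hab hcM']
      exact ⟨wt_bracket ha hb hab hc' hcM', card_bracket ha hb hab hcM'⟩

theorem finsupp_lhom_ext {α A : Type*} [AddCommGroup A] {f g : (α →₀ ℤ) →ₗ[ℤ] A}
    (h : ∀ x, f (Finsupp.single x 1) = g (Finsupp.single x 1)) : f = g :=
  Finsupp.lhom_ext' fun x => LinearMap.ext_ring (h x)

section Weight

variable {n : ℕ} {k : ℤ} (w : Fin n → ℤ)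

theorem projW_inclW (x : Cw n k w) : projW n k w (inclW n k w x) = x := by
  have h : projW n k w ∘ₗ inclW n k w = LinearMap.id :=
    finsupp_lhom_ext fun M => by
      rw [LinearMap.comp_apply, inclW_single, projW_single, dif_pos M.2.2]
      rfl
  exact LinearMap.congr_fun h x

theorem inclW_projW_single (M : B n k) :
    inclW n k w (projW n k w (Finsupp.single M 1)) =
      if wt M.1 = w then Finsupp.single M 1 else 0 := by
  rw [projW_single]
  split_ifs with h
  · rw [inclW_single]
  · rw [map_zero]

theorem inclW_projW_dAux {M : Finset (P n)} (hM : (M.card : ℤ) = k + 1) :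
    inclW n k w (projW n k w (dAux k M)) = if wt M = w then dAux k M else 0 := by
  have key_step : ∀ x ∈ M, ∀ y ∈ M, ∀ T : C n k, T = (if hab : x.1.2 = y.1.1 then
      (let c : P n := ⟨(x.1.1, y.1.2), lt_trans x.2 (by rw [hab]; exact y.2)⟩
       let M' : Finset (P n) := insert c ((M.erase x).erase y)
       if h' : (M'.card : ℤ) = k then
         ((-1 : ℤ) ^ (pos M x + pos M y + pos M' c)) • Finsupp.single (⟨M', h'⟩ : B n k) 1
       else 0)
    else 0) → inclW n k w (projW n k w T) = if wt M = w then T else 0 := by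
    rintro x hx y hy T rfl
    by_cases hab : x.1.2 = y.1.1
    · rw [dif_pos hab]
      obtain ⟨c, hc⟩ : ∃ c : P n, c = ⟨(x.1.1, y.1.2), lt_trans x.2 (by rw [hab]; exact y.2)⟩ :=
        ⟨_, rfl⟩
      have hc' : c.1 = (x.1.1, y.1.2) := by rw [hc]
      simp only [← hc]
      by_cases hcM : c ∈ M
      · have := card_bracket_of_mem hx hy hab hc' hcM
        rw [dif_neg (by omega)]
        simp
      · have := card_bracket hx hy hab hcM
        rw [dif_pos (by omega), map_smul, map_smul, inclW_projW_single,
          wt_bracket hx hy hab hc' hcM, smul_ite, smul_zero]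
    · rw [dif_neg hab]
      simp
  rw [dAux]
  simp only [map_sum]
  split_ifs with hw
  · exact Finset.sum_congr rfl fun x hx => Finset.sum_congr rfl fun y hy =>
      (key_step x hx y hy _ rfl).trans (if_pos hw)
  · exact Finset.sum_eq_zero fun x hx => Finset.sum_eq_zero fun y hy =>
      (key_step x hx y hy _ rfl).trans (if_neg hw)

theorem projW_d (y : C n (k + 1)) :
    projW n k w (d n k y) = dW n k w (projW n (k + 1) w y) := by
  have h : projW n k w ∘ₗ d n k = dW n k w ∘ₗ projW n (k + 1) w :=
    finsupp_lhom_ext fun M => by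
      rw [LinearMap.comp_apply, LinearMap.comp_apply, d_single, projW_single]
      split_ifs with hw
      · rw [dW_single]
      · rw [map_zero, ← projW_inclW w (projW n k w (dAux k M.1)), inclW_projW_dAux w M.2, if_neg hw,
          map_zero]
  exact LinearMap.congr_fun h y

theorem inclW_dW (x : Cw n (k + 1) w) :
    inclW n k w (dW n k w x) = d n k (inclW n (k + 1) w x) := by
  have h : inclW n k w ∘ₗ dW n k w = d n k ∘ₗ inclW n (k + 1) w :=
    finsupp_lhom_ext fun M => by
      rw [LinearMap.comp_apply, LinearMap.comp_apply, dW_single, inclW_projW_dAux w M.2.1,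
        if_pos M.2.2, inclW_single, d_single]
  exact LinearMap.congr_fun h x

theorem castC_inclW {l : ℤ} (h : k = l) (x : Cw n k w) :
    castC n h (inclW n k w x) = inclW n l w (castCw n w h x) := by
  subst h
  have h1 : castC n (rfl : k = k) = LinearEquiv.refl ℤ _ := by
    rw [castC]; exact Finsupp.domLCongr_refl
  have h2 : castCw n w (rfl : k = k) = LinearEquiv.refl ℤ _ := by
    rw [castCw]; exact Finsupp.domLCongr_refl
  rw [h1, h2]
  rfl

theorem dFrom_inclW (x : Cw n k w) :
    dFrom n k (inclW n k w x) = inclW n (k - 1) w (dFromW n k w x) := by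
  rw [dFrom, dFromW, LinearMap.comp_apply, LinearMap.comp_apply, inclW_dW]
  exact congrArg _ (castC_inclW w _ x)

end Weight

theorem castCw_bas {k l : ℤ} (w : Fin 8 → ℤ) (h : k = l) (m : ℕ) :
    castCw 8 w h (bas k w m) = bas l w m := by
  subst h
  have h2 : castCw 8 w (rfl : k = k) = LinearEquiv.refl ℤ _ := by
    rw [castCw]; exact Finsupp.domLCongr_refl
  rw [h2]
  rfl

theorem ofList_eq_zero {k : ℤ} {w : Fin 8 → ℤ} {l : List (ℕ × ℤ)}
    (h : ∀ t ∈ l, bas k w t.1 = 0) : ofList k w l = 0 :=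
  List.sum_eq_zero fun x hx => by
    obtain ⟨t, ht, rfl⟩ := List.mem_map.1 hx
    rw [h t ht, smul_zero]

theorem dW_bas (k : ℤ) (w : Fin 8 → ℤ) (m : ℕ) :
    dW 8 k w (bas (k + 1) w m) = ofList k w (bdMask m) := by
  by_cases h : ((decode m).card : ℤ) = k + 1 ∧ wt (decode m) = w
  · rw [bas, dif_pos h, dW_single, ofList_bdMask k w h.1]
  · rw [bas, dif_neg h, map_zero, ofList_eq_zero]
    intro t ht
    obtain ⟨h1, h2⟩ := wt_card_of_mem_bdMask ht
    exact dif_neg fun h' => h ⟨by omega, h1 ▸ h'.2⟩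

theorem dFromW_bas (k : ℤ) (w : Fin 8 → ℤ) (m : ℕ) :
    dFromW 8 k w (bas k w m) = ofList (k - 1) w (bdMask m) := by
  rw [dFromW, LinearMap.comp_apply, ← dW_bas]
  exact congrArg _ (castCw_bas w _ m)

theorem map_ofList {A : Type*} [AddCommGroup A] {k : ℤ} {w : Fin 8 → ℤ}
    (L : Cw 8 k w →ₗ[ℤ] A) {F : ℕ → A} {l : List (ℕ × ℤ)}
    (h : ∀ t ∈ l, L (bas k w t.1) = F t.1) :
    L (ofList k w l) = (l.map fun t => t.2 • F t.1).sum := by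
  rw [ofList, map_list_sum, List.map_map]
  refine congrArg List.sum (List.map_congr_left fun t ht => ?_)
  rw [Function.comp_apply, map_smul, h t ht]

theorem ofList_extendList (k : ℤ) (w : Fin 8 → ℤ) (F : ℕ → List (ℕ × ℤ)) (l : List (ℕ × ℤ)) :
    ofList k w (extendList F l) = (l.map fun t => t.2 • ofList k w (F t.1)).sum := by
  simp only [extendList, ofList_flatMap, ofList_smulList]

theorem dW_ofList (k : ℤ) (w : Fin 8 → ℤ) (l : List (ℕ × ℤ)) :
    dW 8 k w (ofList (k + 1) w l) = ofList k w (extendList bdMask l) := by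
  rw [ofList_extendList]
  exact map_ofList (dW 8 k w) (F := fun m => ofList k w (bdMask m)) fun t _ => dW_bas k w t.1

theorem dFromW_ofList (k : ℤ) (w : Fin 8 → ℤ) (l : List (ℕ × ℤ)) :
    dFromW 8 k w (ofList k w l) = ofList (k - 1) w (extendList bdMask l) := by
  rw [ofList_extendList]
  exact map_ofList (dFromW 8 k w) (F := fun m => ofList (k - 1) w (bdMask m))
    fun t _ => dFromW_bas k w t.1

/-- The mask `m` has no spurious bits and represents a basis wedge of degree `k` and
weight `w₈`. -/
def IsBasisMask (k : ℤ) (m : ℕ) : Prop :=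
  encodeList (support m) = m ∧ ((decode m).card : ℤ) = k ∧ wt (decode m) = w₈

/-- The linear map on `⟦w₈⟧` given on basis wedges by a function of their masks. -/
noncomputable def onMasks {A : Type*} [AddCommGroup A] (F : ℕ → A) (k : ℤ) :
    Cw 8 k w₈ →ₗ[ℤ] A :=
  Finsupp.linearCombination ℤ fun M => F (encode M.1)

section OnMasks

variable {A : Type*} [AddCommGroup A] {F : ℕ → A} {k : ℤ}

theorem onMasks_bas {m : ℕ} (hm : IsBasisMask k m) : onMasks F k (bas k w₈ m) = F m := by
  rw [bas, dif_pos hm.2, onMasks, Finsupp.linearCombination_single, one_smul, encode_decode, hm.1]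

theorem onMasks_ofList {l : List (ℕ × ℤ)} (hl : ∀ t ∈ l, IsBasisMask k t.1) :
    onMasks F k (ofList k w₈ l) = (l.map fun t => t.2 • F t.1).sum :=
  map_ofList _ fun t ht => onMasks_bas (hl t ht)

theorem linearMap_ext_masks {f g : Cw 8 k w₈ →ₗ[ℤ] A}
    (h : ∀ m ∈ masks, IsBasisMask k m → f (bas k w₈ m) = g (bas k w₈ m)) : f = g :=
  finsupp_lhom_ext fun M => by
    have hM : IsBasisMask k (encode M.1) :=
      ⟨by rw [← encode_decode, decode_encode], by rw [decode_encode]; exact M.2⟩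
    have h' := h _ (encode_mem_masks M.2.2) hM
    rw [bas, dif_pos hM.2] at h'
    simpa only [decode_encode] using h'

theorem IsBasisMask.of_mem_bdMask {l : ℤ} {m : ℕ} (hm : m ∈ masks) (hmk : IsBasisMask k m)
    (hl : l + 1 = k) {t : ℕ × ℤ} (ht : t ∈ bdMask m) : IsBasisMask l t.1 := by
  obtain ⟨h1, h2⟩ := wt_card_of_mem_bdMask ht
  have := hmk.2.1
  exact ⟨(masks_check m hm).2.1 t ht, by omega, h1.trans hmk.2.2⟩

end OnMasks

theorem onMasks_boundary {k l : ℤ} (hl : l + 1 = k) {L : Cw 8 k w₈ →ₗ[ℤ] Cw 8 l w₈}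
    (hL : ∀ m, L (bas k w₈ m) = ofList l w₈ (bdMask m)) {F G : ℕ → ℤ}
    (h : ∀ m ∈ masks, pairing F (bdMask m) = 8 * G m) (x : Cw 8 k w₈) :
    onMasks F l (L x) = 8 * onMasks G k x := by
  have hcomp : onMasks F l ∘ₗ L = (8 : ℤ) • onMasks G k :=
    linearMap_ext_masks fun m hm hmk => by
      rw [LinearMap.comp_apply, hL, onMasks_ofList fun t => hmk.of_mem_bdMask hm hl,
        LinearMap.smul_apply, onMasks_bas hmk]
      exact h m hm
  exact LinearMap.congr_fun hcomp x

/-- The contracting homotopy from degree `k` to degree `l`. -/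
noncomputable def hMap (k l : ℤ) : Cw 8 k w₈ →ₗ[ℤ] Cw 8 l w₈ :=
  onMasks (fun m => ofList l w₈ (hMask m)) k

theorem homotopy_identity (k : ℤ) (x : Cw 8 k w₈) :
    x = onMasks (lookupD 0 coord12) k x • ofList k w₈ gen12 +
      onMasks (lookupD 0 coord11) k x • ofList k w₈ gen11 +
      onMasks (lookupD 0 coord11b) k x • ofList k w₈ gen11b +
      onMasks (lookupD 0 coord10) k x • ofList k w₈ gen10 +
      dW 8 k w₈ (hMap k (k + 1) x) + hMap (k - 1) k (dFromW 8 k w₈ x) := by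
  have h : LinearMap.id =
      (onMasks (lookupD 0 coord12) k).smulRight (ofList k w₈ gen12) +
      (onMasks (lookupD 0 coord11) k).smulRight (ofList k w₈ gen11) +
      (onMasks (lookupD 0 coord11b) k).smulRight (ofList k w₈ gen11b) +
      (onMasks (lookupD 0 coord10) k).smulRight (ofList k w₈ gen10) +
      dW 8 k w₈ ∘ₗ hMap k (k + 1) + hMap (k - 1) k ∘ₗ dFromW 8 k w₈ :=
    linearMap_ext_masks fun m hm hmk => by
      have h1 := congrArg (ofList k w₈) (masks_check m hm).1
      simp only [ofList_collect, ofList_append, prMask, ofList_smulList, ofList_cons, ofList_nil,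
        one_smul, add_zero] at h1
      have h2 : hMap (k - 1) k (ofList (k - 1) w₈ (bdMask m)) =
          ofList k w₈ (extendList hMask (bdMask m)) := by
        rw [ofList_extendList]
        exact onMasks_ofList fun t => hmk.of_mem_bdMask hm (by ring)
      simp only [LinearMap.add_apply, LinearMap.smulRight_apply, LinearMap.comp_apply,
        LinearMap.id_apply, dFromW_bas, hMap, onMasks_bas hmk, dW_ofList]
      rw [hMap] at h2
      rw [h2, ← h1]
      abel
  exact LinearMap.congr_fun h x

theorem eq_add_dW_of_cycle {k : ℤ} {x : Cw 8 k w₈} (hx : dFromW 8 k w₈ x = 0) :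
    x = onMasks (lookupD 0 coord11) k x • ofList k w₈ gen11 +
      onMasks (lookupD 0 coord10) k x • ofList k w₈ gen10 + dW 8 k w₈ (hMap k (k + 1) x) := by
  have h1 := onMasks_boundary (by ring) (dFromW_bas k w₈) (fun m hm => (masks_check m hm).2.2.1) x
  have h2 := onMasks_boundary (by ring) (dFromW_bas k w₈) (fun m hm => (masks_check m hm).2.2.2) x
  rw [hx, map_zero] at h1 h2
  have h3 := homotopy_identity k x
  rw [hx, map_zero, show onMasks (lookupD 0 coord11b) k x = 0 by omega,
    show onMasks (lookupD 0 coord12) k x = 0 by omega] at h3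
  simpa using h3

theorem ofList_eq_zero_of_length_ne {k : ℤ} {w : Fin 8 → ℤ} {l : List (ℕ × ℤ)} {j : ℕ}
    (hl : ∀ t ∈ l, (support t.1).length = j) (hk : k ≠ j) : ofList k w l = 0 :=
  ofList_eq_zero fun t ht => dif_neg fun h => hk <| by rw [← h.1, card_decode, hl t ht]

theorem isBasisMask_of_length {l : List (ℕ × ℤ)} {j : ℕ}
    (hl : ∀ t ∈ l, (support t.1).length = j ∧ encodeList (support t.1) = t.1 ∧
      wt (decode t.1) = w₈) : ∀ t ∈ l, IsBasisMask j t.1 := fun t ht =>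
  ⟨(hl t ht).2.1, by rw [card_decode, (hl t ht).1], (hl t ht).2.2⟩

theorem dFromW_ofList_eq_zero {k : ℤ} {w : Fin 8 → ℤ} {l : List (ℕ × ℤ)}
    (hl : collect (extendList bdMask l) = []) : dFromW 8 k w (ofList k w l) = 0 := by
  rw [dFromW_ofList, ← ofList_collect, hl, ofList_nil]

theorem dW_ofList_eq_smul {k : ℤ} {w : Fin 8 → ℤ} {l l' : List (ℕ × ℤ)}
    (hl : collect (extendList bdMask l ++ smulList (-8) l') = []) :
    dW 8 k w (ofList (k + 1) w l) = (8 : ℤ) • ofList k w l' := by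
  have h := congrArg (ofList k w) hl
  rw [ofList_collect, ofList_append, ofList_smulList, ofList_nil, neg_smul, add_neg_eq_zero] at h
  rw [dW_ofList, h]

theorem nonempty_Hw_equiv {n N : ℕ} {k : ℤ} {w : Fin n → ℤ} {e : Cw n k w} {f : Cw n (k + 1) w}
    {φ : Cw n k w →ₗ[ℤ] ℤ} (he : dFromW n k w e = 0) (hf : dW n k w f = (N : ℤ) • e)
    (hφe : φ e = 1) (hφ : ∀ y, (N : ℤ) ∣ φ (dW n k w y))
    (h : ∀ x, dFromW n k w x = 0 → ∃ y, x = φ x • e + dW n k w y) :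
    Nonempty (Hw n k w ≃ₗ[ℤ] ZMod N) := by
  let ψ : ZW n k w →ₗ[ℤ] ZMod N :=
    (Int.castAddHom (ZMod N)).toIntLinearMap ∘ₗ φ ∘ₗ (ZW n k w).subtype
  have hψ : ∀ x, ψ x = ((φ x.1 : ℤ) : ZMod N) := fun _ => rfl
  have hker : HwSub n k w = LinearMap.ker ψ := by
    ext x
    rw [LinearMap.mem_ker, hψ, ZMod.intCast_zmod_eq_zero_iff_dvd, HwSub, Submodule.mem_comap,
      Submodule.mem_inf]
    constructor
    · rintro ⟨⟨y, hy⟩, -⟩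
      have h1 := hφ y
      rw [hy] at h1
      exact h1
    · rintro ⟨c, hc⟩
      obtain ⟨y, hy⟩ := h x.1 x.2
      refine ⟨⟨c • f + y, ?_⟩, x.2⟩
      rw [map_add, map_smul, hf, smul_smul, mul_comm, ← hc, ← hy]
      rfl
  have hsurj : Function.Surjective ψ := fun z => by
    obtain ⟨c, rfl⟩ := ZMod.intCast_surjective z
    refine ⟨c • ⟨e, he⟩, ?_⟩
    rw [map_zsmul, hψ, hφe]
    simp
  exact ⟨(Submodule.quotEquivOfEq _ _ hker).trans (ψ.quotKerEquivOfSurjective hsurj)⟩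

theorem exists_addOrderOf_Hnil {n p m : ℕ} [Fact p.Prime] {k : ℤ} {w : Fin n → ℤ} {e : Cw n k w}
    {f : Cw n (k + 1) w} {φ : Cw n k w →ₗ[ℤ] ℤ} (he : dFromW n k w e = 0)
    (hf : dW n k w f = (p ^ (m + 1) : ℕ) • e) (hφe : φ e = 1)
    (hφ : ∀ y, ((p ^ (m + 1) : ℕ) : ℤ) ∣ φ (dW n k w y)) :
    ∃ x : Hnil n k, addOrderOf x = p ^ (m + 1) := by
  have hz : inclW n k w e ∈ Zfull n k := by
    rw [Zfull, LinearMap.mem_ker, dFrom_inclW, he, map_zero]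
  let z : Zfull n k := ⟨inclW n k w e, hz⟩
  let x : Hnil n k := (HnilSub n k).mkQ z
  have hx : ∀ c : ℕ, c • x = 0 ↔ ∃ y, d n k y = c • inclW n k w e := by
    intro c
    have h1 : c • x = (HnilSub n k).mkQ (c • z) := (map_nsmul (HnilSub n k).mkQ c z).symm
    rw [h1]
    refine (Submodule.Quotient.mk_eq_zero _).trans ?_
    rw [HnilSub, Submodule.mem_comap, Submodule.mem_inf]
    exact ⟨fun h => h.1, fun h => ⟨h, (c • z).2⟩⟩
  refine ⟨x, addOrderOf_eq_prime_pow ?_ ?_⟩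
  · rw [hx]
    rintro ⟨y, hy⟩
    have h1 := congrArg (projW n k w) hy
    rw [projW_d, map_nsmul, projW_inclW] at h1
    have h2 := hφ (projW n (k + 1) w y)
    rw [h1, map_nsmul, hφe, nsmul_one] at h2
    have h3 := (Nat.pow_dvd_pow_iff_le_right (Fact.out : p.Prime).one_lt).1
      (Int.natCast_dvd_natCast.1 h2)
    omega
  · rw [hx]
    exact ⟨inclW n (k + 1) w f, by rw [← inclW_dW, hf, map_nsmul]⟩

/-- Example 3.7: for `w = (2,4,7,5,4,2,5,7) ∈ 𝒮_8`, `H_k⟦w⟧ ≅ ℤ/8` for `k ∈ {10,11}` and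
`H_k⟦w⟧ = 0` otherwise; consequently `H_10(nil_8; ℤ)` has an element of order `8`. -/
theorem nil8_eight_torsion :
    Sn 8 ![2, 4, 7, 5, 4, 2, 5, 7] ∧
    Nonempty (Hw 8 10 ![2, 4, 7, 5, 4, 2, 5, 7] ≃ₗ[ℤ] ZMod 8) ∧
    Nonempty (Hw 8 11 ![2, 4, 7, 5, 4, 2, 5, 7] ≃ₗ[ℤ] ZMod 8) ∧
    (∀ k : ℤ, k ≠ 10 → k ≠ 11 → Subsingleton (Hw 8 k ![2, 4, 7, 5, 4, 2, 5, 7])) ∧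
    ∃ x : Hnil 8 10, addOrderOf x = 8 := by
  obtain ⟨hd12, hd11, hd11b, hd10, he11, he10⟩ := gen_check
  obtain ⟨hg11, hg10⟩ := gen_wt
  have hc10 : onMasks (lookupD 0 coord10) 10 (ofList 10 w₈ gen10) = 1 :=
    (onMasks_ofList (isBasisMask_of_length hg10)).trans he10
  have hc11 : onMasks (lookupD 0 coord11) 11 (ofList 11 w₈ gen11) = 1 :=
    (onMasks_ofList (isBasisMask_of_length hg11)).trans he11
  have hb10 : ∀ y, (8 : ℤ) ∣ onMasks (lookupD 0 coord10) 10 (dW 8 10 w₈ y) := fun y =>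
    ⟨_, onMasks_boundary rfl (dW_bas 10 w₈) (fun m hm => (masks_check m hm).2.2.1) y⟩
  have hb11 : ∀ y, (8 : ℤ) ∣ onMasks (lookupD 0 coord11) 11 (dW 8 11 w₈ y) := fun y =>
    ⟨_, onMasks_boundary rfl (dW_bas 11 w₈) (fun m hm => (masks_check m hm).2.2.2) y⟩
  have hz10 : ∀ k : ℤ, k ≠ 10 → ofList k w₈ gen10 = 0 := fun k hk =>
    ofList_eq_zero_of_length_ne (fun t ht => (hg10 t ht).1) hk
  have hz11 : ∀ k : ℤ, k ≠ 11 → ofList k w₈ gen11 = 0 := fun k hk =>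
    ofList_eq_zero_of_length_ne (fun t ht => (hg11 t ht).1) hk
  refine ⟨⟨by decide, by decide⟩, ?_, ?_, fun k hk10 hk11 => ?_, ?_⟩
  · refine nonempty_Hw_equiv (dFromW_ofList_eq_zero hd10) (dW_ofList_eq_smul hd11b) hc10 hb10
      fun x hx => ⟨hMap 10 (10 + 1) x, (eq_add_dW_of_cycle hx).trans ?_⟩
    rw [hz11 10 (by norm_num), smul_zero, zero_add]
  · refine nonempty_Hw_equiv (dFromW_ofList_eq_zero hd11) (dW_ofList_eq_smul hd12) hc11 hb11
      fun x hx => ⟨hMap 11 (11 + 1) x, (eq_add_dW_of_cycle hx).trans ?_⟩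
    rw [hz10 11 (by norm_num), smul_zero, add_zero]
  · refine Submodule.Quotient.subsingleton_iff.2 (eq_top_iff.2 fun x _ => ?_)
    refine Submodule.mem_comap.2 ⟨⟨hMap k (k + 1) x.1,
      Eq.symm <| (eq_add_dW_of_cycle x.2).trans ?_⟩, x.2⟩
    rw [hz10 k hk10, hz11 k hk11, smul_zero, smul_zero, zero_add, zero_add]
  · have : Fact (Nat.Prime 2) := ⟨Nat.prime_two⟩
    refine exists_addOrderOf_Hnil (p := 2) (m := 2) (dFromW_ofList_eq_zero hd10)
      ((dW_ofList_eq_smul hd11b).trans ?_) hc10 hb10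
    exact natCast_zsmul _ 8

end Nil
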